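/- Let m,n ≥ 2, X = {1,...,m} × {1,...,n}, P the partition of X into blocks C_i = {i} × {1,...,n}, and S = E(X,P) the submonoid of T(X,P) generated by its idempotents. Let 1 ≤ i < j ≤ m and f ∈ S_n, and suppose e_{ij;f} = gh where g,h ∈ S and g ≠ 1. Then (i) the kernel of ḡ is the equivalence ε_{ij} on {1,...,m} whose unique non-trivial class is {i,j}, (ii) g_1,...,g_m are all permutations of {1,...,n}, and (iii) g_j g_i^{−1} = f. Consequently, every generating set G of S contains, for each pair i < j and each f ∈ S_n, an element g satisfying (i)–(iii). -/

import Mathlib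

/-- `BP f` says that `f : X → X`, with `X = {1,…,m} × {1,…,n}`, preserves the partition of
`X` into the blocks `C_i = {i} × {1,…,n}`, i.e. `f ∈ T(X,P)`. -/
def BP {m n : ℕ} (f : Fin m × Fin n → Fin m × Fin n) : Prop :=
  ∀ i : Fin m, ∃ j : Fin m, ∀ x : Fin n, (f (i, x)).1 = j

/-- `fbar hn f = f̄`, the induced transformation of `{1,…,m}` (for `f ∈ T(X,P)`). -/
def fbar {m n : ℕ} (hn : 0 < n) (f : Fin m × Fin n → Fin m × Fin n) (i : Fin m) : Fin m :=
  (f (i, ⟨0, hn⟩)).1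

/-- `comp' f i = f_i`, the `i`-th component of `f ∈ T(X,P)` acting on `{1,…,n}`. -/
def comp' {m n : ℕ} (f : Fin m × Fin n → Fin m × Fin n) (i : Fin m) (x : Fin n) : Fin n :=
  (f (i, x)).2

/-- `eijf i j g = e_{ij;g} = [1,…,1,g,1,…,1; e_{ij}]`, with `g` in the `j`-th position and
where `e_{ij} ∈ T_m` sends `j` to `i` and fixes all other points. -/
def eijf {m n : ℕ} (i j : Fin m) (g : Fin n → Fin n) : Function.End (Fin m × Fin n) :=
  fun p => (if p.1 = j then i else p.1, if p.1 = j then g p.2 else p.2)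

theorem BP.one {m n : ℕ} : BP (1 : Function.End (Fin m × Fin n)) :=
  fun i => ⟨i, fun _ => rfl⟩

theorem BP.mul {m n : ℕ} {u v : Function.End (Fin m × Fin n)} (hu : BP u) (hv : BP v) :
    BP (u * v) := by
  intro i
  obtain ⟨j, hj⟩ := hv i
  obtain ⟨k, hk⟩ := hu j
  refine ⟨k, fun x => ?_⟩
  change (u (v (i, x))).1 = k
  rw [← hk (v (i, x)).2, ← hj x]

theorem BP.fst_eq_fbar {m n : ℕ} {u : Fin m × Fin n → Fin m × Fin n} (hu : BP u) (hn : 0 < n)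
    (i : Fin m) (x : Fin n) : (u (i, x)).1 = fbar hn u i := by
  obtain ⟨j, hj⟩ := hu i
  rw [fbar, hj, hj]

theorem BP.of_mem_closure {m n : ℕ} {u : Function.End (Fin m × Fin n)}
    (hu : u ∈ Submonoid.closure {u : Function.End (Fin m × Fin n) | BP u ∧ u * u = u}) :
    BP u := by
  induction hu using Submonoid.closure_induction with
  | mem u h => exact h.1
  | one => exact BP.one
  | mul u v _ _ hu hv => exact hu.mul hv

/-- In a finite transformation monoid the only injective product of idempotents is `1`. -/
theorem eq_one_of_injective_of_mem_closure {α : Type*} [Finite α] {s : Set (Function.End α)}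
    (hs : ∀ u ∈ s, u * u = u) {u : Function.End α} (hu : u ∈ Submonoid.closure s)
    (hinj : Function.Injective u) : u = 1 := by
  induction hu using Submonoid.closure_induction with
  | mem u h => exact funext fun x => hinj (congrFun (hs u h) x)
  | one => rfl
  | mul u v _ _ hu hv =>
    have hv1 : v = 1 := hv (Function.Injective.of_comp (f := u) hinj)
    subst hv1
    rw [mul_one] at hinj ⊢
    exact hu hinj

theorem exists_right_factor_ne_one {M : Type*} [Monoid M] {G : Set M} {x : M}
    (hx : x ∈ Submonoid.closure G) (hx1 : x ≠ 1) :
    ∃ g ∈ G, ∃ h ∈ Submonoid.closure G, g ≠ 1 ∧ x = h * g := by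
  induction hx using Submonoid.closure_induction with
  | mem x h => exact ⟨x, h, 1, one_mem _, hx1, (one_mul x).symm⟩
  | one => exact absurd rfl hx1
  | mul x y hx hy ihx ihy =>
    by_cases hy1 : y = 1
    · subst hy1
      rw [mul_one] at hx1 ⊢
      exact ihx hx1
    · obtain ⟨g, hg, h, hh, hg1, rfl⟩ := ihy hy1
      exact ⟨g, hg, x * h, mul_mem hx hh, hg1, (mul_assoc x h g).symm⟩

theorem bp_eijf {m n : ℕ} (i j : Fin m) (f : Fin n → Fin n) : BP (eijf i j f) :=
  fun a => ⟨if a = j then i else a, fun _ => rfl⟩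

theorem eijf_mul_self {m n : ℕ} {i j : Fin m} (hij : i ≠ j) (f : Fin n → Fin n) :
    eijf i j f * eijf i j f = eijf i j f := by
  funext p
  change eijf i j f (eijf i j f p) = _
  by_cases h : p.1 = j <;> simp [eijf, h, hij]

theorem eijf_ne_one {m n : ℕ} {i j : Fin m} (hij : i ≠ j) (hn : 0 < n) (f : Fin n → Fin n) :
    eijf i j f ≠ 1 := by
  intro h
  have := congrArg Prod.fst (congrFun h (j, ⟨0, hn⟩))
  change (if j = j then i else j) = j at this
  exact hij (by simpa using this)

theorem right_factor_of_eijf {m n : ℕ} (hn : 0 < n) {i j : Fin m} (hij : i ≠ j)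
    {f : Fin n → Fin n} (hf : Function.Bijective f) {g h : Function.End (Fin m × Fin n)}
    (hg : g ∈ Submonoid.closure {u : Function.End (Fin m × Fin n) | BP u ∧ u * u = u})
    (hh : BP h) (hg1 : g ≠ 1) (he : eijf i j f = h * g) :
    (∀ a b : Fin m, fbar hn g a = fbar hn g b ↔
        (a = b ∨ (a = i ∧ b = j) ∨ (a = j ∧ b = i))) ∧
      (∀ r : Fin m, Function.Bijective (comp' g r)) ∧
      comp' g i ∘ f = comp' g j := by
  have hgBP := BP.of_mem_closure hg
  have hgp (a : Fin m) (x : Fin n) : g (a, x) = (fbar hn g a, comp' g a x) :=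
    Prod.ext (hgBP.fst_eq_fbar hn a x) rfl
  have hfst (a : Fin m) : (if a = j then i else a) = fbar hn h (fbar hn g a) := by
    have := congrArg Prod.fst (congrFun he (a, ⟨0, hn⟩))
    change (if a = j then i else a) = (h (g (a, ⟨0, hn⟩))).1 at this
    rwa [hgp, hh.fst_eq_fbar hn] at this
  have hsnd (a : Fin m) (x : Fin n) :
      (if a = j then f x else x) = comp' h (fbar hn g a) (comp' g a x) := by
    have := congrArg Prod.snd (congrFun he (a, x))
    change (if a = j then f x else x) = (h (g (a, x))).2 at this
    rwa [hgp] at this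
  have hbij (r : Fin m) : Function.Bijective (comp' g r) := by
    refine Finite.injective_iff_bijective.mp fun x y hxy => ?_
    have := (hsnd r x).trans ((congrArg _ hxy).trans (hsnd r y).symm)
    split_ifs at this
    exacts [hf.1 this, this]
  have hker (a b : Fin m) (hab : fbar hn g a = fbar hn g b) :
      a = b ∨ (a = i ∧ b = j) ∨ (a = j ∧ b = i) := by
    have := (hfst a).trans ((congrArg _ hab).trans (hfst b).symm)
    split_ifs at this <;> grind
  have hgij : fbar hn g i = fbar hn g j := by
    by_contra hne
    refine hg1 (eq_one_of_injective_of_mem_closure (fun u hu => hu.2) hg ?_)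
    rintro ⟨a, x⟩ ⟨b, y⟩ hxy
    rw [hgp, hgp, Prod.mk.injEq] at hxy
    rcases hker a b hxy.1 with rfl | ⟨rfl, rfl⟩ | ⟨rfl, rfl⟩
    · rw [(hbij a).1 hxy.2]
    · exact absurd hxy.1 hne
    · exact absurd hxy.1.symm hne
  refine ⟨fun a b => ⟨hker a b, ?_⟩, hbij, funext fun x => ?_⟩
  · rintro (rfl | ⟨rfl, rfl⟩ | ⟨rfl, rfl⟩)
    exacts [rfl, hgij, hgij.symm]
  · obtain ⟨y, hy⟩ := (hbij i).2 (comp' g j x)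
    have hx := hsnd j x
    rw [if_pos rfl, ← hgij, ← hy, ← hsnd i y, if_neg hij] at hx
    rw [Function.comp_apply, hx, hy]

/-- Let `m, n ≥ 2`, `S = E(X,P)` the idempotent-generated submonoid of
`T(X,P)`, `i < j` in `{1,…,m}` and `f ∈ S_n`.  If `e_{ij;f} = gh` with `g, h ∈ S` and
`g ≠ 1` (maps act on the right, so the composite is `h ∘ g`, i.e. `h * g` in
`Function.End`), then (i) `ker ḡ = ε_{ij}`, the equivalence on `{1,…,m}` whose unique
non-trivial class is `{i,j}`; (ii) every component `g_r` is a permutation of `{1,…,n}`;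
and (iii) `g_j g_i^{−1} = f`, i.e. `g_i ∘ f = g_j`.  Consequently every generating set `G`
of `S` contains such an element `g` (for this pair `i < j` and this `f`). -/
theorem stmt_15 (m n : ℕ) (hm : 2 ≤ m) (hn : 2 ≤ n)
    (i j : Fin m) (hij : i < j) (f : Fin n → Fin n) (hf : Function.Bijective f) :
    (∀ g h : Function.End (Fin m × Fin n),
      g ∈ Submonoid.closure {u : Function.End (Fin m × Fin n) | BP u ∧ u * u = u} →
      h ∈ Submonoid.closure {u : Function.End (Fin m × Fin n) | BP u ∧ u * u = u} →
      g ≠ 1 → eijf i j f = h * g →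
        ((∀ a b : Fin m, fbar (show 0 < n by omega) g a = fbar (show 0 < n by omega) g b ↔
            (a = b ∨ (a = i ∧ b = j) ∨ (a = j ∧ b = i))) ∧
         (∀ r : Fin m, Function.Bijective (comp' g r)) ∧
         comp' g i ∘ f = comp' g j)) ∧
    ∀ G : Set (Function.End (Fin m × Fin n)),
      Submonoid.closure G
        = Submonoid.closure {u : Function.End (Fin m × Fin n) | BP u ∧ u * u = u} →
      ∃ g ∈ G,
        (∀ a b : Fin m, fbar (show 0 < n by omega) g a = fbar (show 0 < n by omega) g b ↔
            (a = b ∨ (a = i ∧ b = j) ∨ (a = j ∧ b = i))) ∧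
        (∀ r : Fin m, Function.Bijective (comp' g r)) ∧
        comp' g i ∘ f = comp' g j := by
  refine ⟨fun g h hg hh hg1 he =>
    right_factor_of_eijf _ hij.ne hf hg (BP.of_mem_closure hh) hg1 he, fun G hG => ?_⟩
  have he : eijf i j f ∈ Submonoid.closure G :=
    hG ▸ Submonoid.subset_closure ⟨bp_eijf i j f, eijf_mul_self hij.ne f⟩
  obtain ⟨g, hg, h, hh, hg1, hgh⟩ :=
    exists_right_factor_ne_one he (eijf_ne_one hij.ne (by omega) f)
  exact ⟨g, hg, right_factor_of_eijf _ hij.ne hf (hG ▸ Submonoid.subset_closure hg)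
    (BP.of_mem_closure (hG ▸ hh)) hg1 hgh⟩
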